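/- arXiv:2504.09505 — 2 statements merged into one kernel-verified Lean document; each statement's English description precedes it below -/
import Mathlib

section
/- Let R be a commutative noetherian local ring, x ∈ R a nonzerodivisor, and N a finitely generated R/xR-module. Then for every m ≥ 0 there is a stable isomorphism Ω_R^{m+1}(N) ≅ Ω_R(Ω^m_{R/xR}(N)), i.e., these modules become isomorphic after adding suitable finitely generated projective R-modules. -/
noncomputable section

/-- `S` is an `n`-th syzygy of `M` (with respect to some choice of free covers). -/
def IsSyzygyOf (R : Type) [Ring R] :
    ℕ → (S : Type) → [AddCommGroup S] → [Module R S] →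
      (M : Type) → [AddCommGroup M] → [Module R M] → Prop
  | 0, S, _, _, M, _, _ => Nonempty (S ≃ₗ[R] M)
  | n + 1, S, _, _, M, _, _ => ∃ (b : ℕ) (p : (Fin b → R) →ₗ[R] M),
      Function.Surjective p ∧ IsSyzygyOf R n S (LinearMap.ker p)

/-- Two modules are stably isomorphic if they become isomorphic after adding finitely generated
projective modules. -/
def StablyIso (R : Type) [CommRing R] (S U : Type) [AddCommGroup S] [Module R S]
    [AddCommGroup U] [Module R U] : Prop :=
  ∃ (P Q : ModuleCat.{0} R), Module.Finite R P ∧ Module.Projective R P ∧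
    Module.Finite R Q ∧ Module.Projective R Q ∧ Nonempty ((S × P) ≃ₗ[R] (U × Q))

section StablyIso

variable {R : Type} [CommRing R]
  {S : Type} [AddCommGroup S] [Module R S] {U : Type} [AddCommGroup U] [Module R U]
  {V : Type} [AddCommGroup V] [Module R V]

theorem StablyIso.of_prod_equiv (P Q : Type) [AddCommGroup P] [Module R P] [Module.Finite R P]
    [Module.Projective R P] [AddCommGroup Q] [Module R Q] [Module.Finite R Q]
    [Module.Projective R Q] (e : (S × P) ≃ₗ[R] (U × Q)) : StablyIso R S U :=
  ⟨ModuleCat.of R P, ModuleCat.of R Q, ‹_›, ‹_›, ‹_›, ‹_›, ⟨e⟩⟩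

theorem StablyIso.of_equiv (e : S ≃ₗ[R] U) : StablyIso R S U :=
  .of_prod_equiv R R (e.prodCongr (.refl R R))

theorem StablyIso.symm (h : StablyIso R S U) : StablyIso R U S := by
  obtain ⟨P, Q, hP, hP', hQ, hQ', ⟨e⟩⟩ := h
  exact ⟨Q, P, hQ, hQ', hP, hP', ⟨e.symm⟩⟩

theorem StablyIso.trans (h : StablyIso R S U) (h' : StablyIso R U V) : StablyIso R S V := by
  obtain ⟨P, Q, _, _, _, _, ⟨e⟩⟩ := h
  obtain ⟨P', Q', _, _, _, _, ⟨e'⟩⟩ := h'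
  refine .of_prod_equiv (P × P') (Q' × Q) ?_
  exact (LinearEquiv.prodAssoc R S P P').symm ≪≫ₗ e.prodCongr (.refl R P') ≪≫ₗ
    LinearEquiv.prodAssoc R U Q P' ≪≫ₗ (LinearEquiv.refl R U).prodCongr (.prodComm R Q P') ≪≫ₗ
    (LinearEquiv.prodAssoc R U P' Q).symm ≪≫ₗ e'.prodCongr (.refl R Q) ≪≫ₗ
    LinearEquiv.prodAssoc R V Q' Q

end StablyIso

section Schanuel

variable {R : Type} [CommRing R]
  {F : Type} [AddCommGroup F] [Module R F] {F' : Type} [AddCommGroup F'] [Module R F']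
  {X : Type} [AddCommGroup X] [Module R X] {X' : Type} [AddCommGroup X'] [Module R X']

/-- Schanuel's lemma. -/
theorem LinearMap.nonempty_ker_prod_equiv [Module.Projective R F] [Module.Projective R F']
    (p : F →ₗ[R] X) (p' : F' →ₗ[R] X) (hp : Function.Surjective p)
    (hp' : Function.Surjective p') :
    Nonempty ((LinearMap.ker p × F') ≃ₗ[R] (LinearMap.ker p' × F)) := by
  obtain ⟨f, hf⟩ := Module.projective_lifting_property p' p hp'
  obtain ⟨g, hg⟩ := Module.projective_lifting_property p p' hp
  have hf' : ∀ a, p' (f a) = p a := fun a => LinearMap.congr_fun hf a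
  have hg' : ∀ a, p (g a) = p' a := fun a => LinearMap.congr_fun hg a
  refine ⟨{
    toFun := fun z => (⟨z.2 - f (z.1 + g z.2), by simp [hf', hg']⟩, z.1 + g z.2)
    invFun := fun z => (⟨z.2 - g (z.1 + f z.2), by simp [hf', hg']⟩, z.1 + f z.2)
    map_add' := ?_
    map_smul' := ?_
    left_inv := ?_
    right_inv := ?_ }⟩
  · intro a b
    ext <;> simp <;> abel
  · intro r a
    ext <;> simp [smul_sub, smul_add]
  · intro a
    ext <;> simp
  · intro a
    ext <;> simp

theorem LinearMap.stablyIso_ker_of_stablyIso [Module.Projective R F] [Module.Finite R F]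
    [Module.Projective R F'] [Module.Finite R F'] (h : StablyIso R X X')
    (p : F →ₗ[R] X) (p' : F' →ₗ[R] X') (hp : Function.Surjective p)
    (hp' : Function.Surjective p') :
    StablyIso R (LinearMap.ker p) (LinearMap.ker p') := by
  have ker_prodMap {G Y : Type} [AddCommGroup G] [Module R G] [AddCommGroup Y] [Module R Y]
      {Z : Type} [AddCommGroup Z] [Module R Z] {P : Type} [AddCommGroup P] [Module R P]
      (t : G →ₗ[R] Y) (e : (Y × P) ≃ₗ[R] Z) :
      StablyIso R (LinearMap.ker t) (LinearMap.ker (e.toLinearMap ∘ₗ t.prodMap .id)) := by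
    let i : LinearMap.ker t →ₗ[R] G × P := LinearMap.inl R G P ∘ₗ (LinearMap.ker t).subtype
    have hi : Function.Injective i := fun a b hab => by
      simpa [i] using hab
    refine .of_equiv (LinearEquiv.ofInjective i hi ≪≫ₗ LinearEquiv.ofEq _ _ ?_)
    ext ⟨a, b⟩
    simp [i, eq_comm]
  obtain ⟨P, Q, _, _, _, _, ⟨e⟩⟩ := h
  obtain ⟨E⟩ := LinearMap.nonempty_ker_prod_equiv (e.toLinearMap ∘ₗ p.prodMap .id)
    ((LinearEquiv.refl R (X' × Q)).toLinearMap ∘ₗ p'.prodMap .id)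
    (e.surjective.comp (hp.prodMap Function.surjective_id))
    ((LinearEquiv.refl R (X' × Q)).surjective.comp (hp'.prodMap Function.surjective_id))
  exact (ker_prodMap p e).trans ((StablyIso.of_prod_equiv _ _ E).trans (ker_prodMap p' _).symm)

theorem LinearMap.stablyIso_ker [Module.Projective R F] [Module.Finite R F]
    [Module.Projective R F'] [Module.Finite R F']
    (p : F →ₗ[R] X) (p' : F' →ₗ[R] X) (hp : Function.Surjective p)
    (hp' : Function.Surjective p') :
    StablyIso R (LinearMap.ker p) (LinearMap.ker p') :=
  LinearMap.stablyIso_ker_of_stablyIso (.of_equiv (.refl R X)) p p' hp hp'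

/-- An extension of `X` by a finitely generated projective module has the same first syzygies
as `X`, up to stable isomorphism. -/
theorem LinearMap.exists_surjective_stablyIso_ker_of_exact {E K : Type}
    [AddCommGroup E] [Module R E] [AddCommGroup K] [Module R K] [Module.Projective R F]
    (j : E →ₗ[R] K) (π : K →ₗ[R] X) (hj : Function.Injective j) (hπ : Function.Surjective π)
    (hex : Function.Exact j π) (p : F →ₗ[R] X) (hp : Function.Surjective p) :
    ∃ φ : F × E →ₗ[R] K, Function.Surjective φ ∧
      StablyIso R (LinearMap.ker φ) (LinearMap.ker p) := by
  obtain ⟨l, hl⟩ := Module.projective_lifting_property π p hπ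
  have hl' : ∀ a, π (l a) = p a := fun a => LinearMap.congr_fun hl a
  have hπj : ∀ a, π (j a) = 0 := hex.apply_apply_eq_zero
  refine ⟨l.coprod j, fun k => ?_, ?_⟩
  · obtain ⟨u, hu⟩ := hp (π k)
    obtain ⟨v, hv⟩ := (hex (k - l u)).1 (by simp [hl', hu])
    exact ⟨(u, v), by simp [hv]⟩
  · let ψ : LinearMap.ker (l.coprod j) →ₗ[R] LinearMap.ker p :=
      (LinearMap.fst R F E).restrict fun z hz => by
        have h := congrArg π (LinearMap.mem_ker.1 hz)
        simpa [hl', hπj] using h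
    refine .of_equiv (LinearEquiv.ofBijective ψ ⟨?_, ?_⟩)
    · refine (injective_iff_map_eq_zero ψ).2 ?_
      rintro ⟨⟨u, v⟩, huv⟩ h
      have hu : u = 0 := congrArg Subtype.val h
      subst hu
      have hv : v = 0 := hj (by simpa using huv)
      subst hv
      rfl
    · rintro ⟨u, hu⟩
      obtain ⟨v, hv⟩ := (hex (-l u)).1 (by simpa [hl'] using hu)
      exact ⟨⟨(u, v), by simp [hv]⟩, rfl⟩

end Schanuel

theorem IsSyzygyOf.stablyIso {R : Type} [CommRing R] (n : ℕ)
    {S S' M M' : Type} [AddCommGroup S] [Module R S] [AddCommGroup S'] [Module R S']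
    [AddCommGroup M] [Module R M] [AddCommGroup M'] [Module R M']
    (hS : IsSyzygyOf R n S M) (hS' : IsSyzygyOf R n S' M') (h : StablyIso R M M') :
    StablyIso R S S' := by
  induction n generalizing M M' with
  | zero =>
    obtain ⟨e⟩ := hS
    obtain ⟨e'⟩ := hS'
    exact (StablyIso.of_equiv e).trans (h.trans (.of_equiv e'.symm))
  | succ n ih =>
    obtain ⟨b, p, hp, hS⟩ := hS
    obtain ⟨b', p', hp', hS'⟩ := hS'
    exact ih hS hS' (LinearMap.stablyIso_ker_of_stablyIso h p p' hp hp')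

theorem exists_isSyzygyOf (R : Type) [CommRing R] [IsNoetherianRing R] (n : ℕ)
    (M : Type) [AddCommGroup M] [Module R M] [Module.Finite R M] :
    ∃ (S : ModuleCat.{0} R), IsSyzygyOf R n S M := by
  induction n generalizing M with
  | zero => exact ⟨ModuleCat.of R M, ⟨.refl R M⟩⟩
  | succ n ih =>
    obtain ⟨b, p, hp⟩ := Module.Finite.exists_fin' R M
    obtain ⟨S, hS⟩ := ih (LinearMap.ker p)
    exact ⟨S, b, p, hp, hS⟩

section Quotient

variable {R : Type} [CommRing R] {x : R} {N : Type} [AddCommGroup N]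
  [Module (R ⧸ Ideal.span {x}) N] [Module R N] [IsScalarTower R (R ⧸ Ideal.span {x}) N]

/-- If `x` is a nonzerodivisor, then the kernel of the free cover of `N` over `R` induced by a
free cover `q` over `R/xR` is an extension of `ker q` by a free module. -/
theorem exists_extension_ker_of_isSMulRegular (hx : IsSMulRegular R x) {b : ℕ}
    (q : (Fin b → R ⧸ Ideal.span {x}) →ₗ[R ⧸ Ideal.span {x}] N) (hq : Function.Surjective q) :
    ∃ (p : (Fin b → R) →ₗ[R] N) (j : (Fin b → R) →ₗ[R] LinearMap.ker p)
      (π : LinearMap.ker p →ₗ[R] LinearMap.ker q),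
      Function.Surjective p ∧ Function.Injective j ∧ Function.Surjective π ∧
        Function.Exact j π := by
  let μ : (Fin b → R) →ₗ[R] (Fin b → R ⧸ Ideal.span {x}) :=
    (Ideal.Quotient.mkₐ R (Ideal.span {x})).toLinearMap.compLeft (Fin b)
  have hμ : Function.Surjective μ := fun v => by
    choose w hw using fun i => Ideal.Quotient.mk_surjective (v i)
    exact ⟨w, funext hw⟩
  have hμx : ∀ v, μ (x • v) = 0 := fun v => funext fun i =>
    Ideal.Quotient.eq_zero_iff_mem.2 (Ideal.mem_span_singleton'.2 ⟨v i, mul_comm _ _⟩)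
  let p : (Fin b → R) →ₗ[R] N := q.restrictScalars R ∘ₗ μ
  let j : (Fin b → R) →ₗ[R] LinearMap.ker p :=
    (x • LinearMap.id).codRestrict _ fun v => by
      change q (μ (x • v)) = 0
      rw [hμx, map_zero]
  let π : LinearMap.ker p →ₗ[R] LinearMap.ker q :=
    { toFun := fun k => ⟨μ k, k.2⟩
      map_add' := fun a b => Subtype.ext (map_add μ _ _)
      map_smul' := fun r a => Subtype.ext (map_smul μ r _) }
  refine ⟨p, j, π, hq.comp hμ, fun a c h => ?_, ?_, fun k => ⟨fun hk => ?_, ?_⟩⟩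
  · exact funext fun i => hx (congrFun (congrArg Subtype.val h) i)
  · rintro ⟨k, hk⟩
    obtain ⟨w, rfl⟩ := hμ k
    exact ⟨⟨w, hk⟩, rfl⟩
  · have hk' : ∀ i, ∃ a, a * x = k.1 i := fun i =>
      Ideal.mem_span_singleton'.1 (Ideal.Quotient.eq_zero_iff_mem.1
        (congrFun (congrArg Subtype.val hk) i))
    choose v hv using hk'
    exact ⟨v, Subtype.ext (funext fun i => (mul_comm _ _).trans (hv i))⟩
  · rintro ⟨v, rfl⟩
    exact Subtype.ext (hμx v)

theorem stablyIso_of_isSyzygyOf_quotient [IsNoetherianRing R] (hx : IsSMulRegular R x)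
    [Module.Finite (R ⧸ Ideal.span {x}) N] (m : ℕ)
    {S : Type} [AddCommGroup S] [Module R S] (hS : IsSyzygyOf R (m + 1) S N)
    {T : Type} [AddCommGroup T] [Module (R ⧸ Ideal.span {x}) T] [Module R T]
    [IsScalarTower R (R ⧸ Ideal.span {x}) T]
    (hT : IsSyzygyOf (R ⧸ Ideal.span {x}) m T N)
    {U : Type} [AddCommGroup U] [Module R U] (hU : IsSyzygyOf R 1 U T) :
    StablyIso R S U := by
  induction m generalizing N S with
  | zero =>
    obtain ⟨e⟩ := hT
    exact IsSyzygyOf.stablyIso 1 hS hU (.of_equiv (e.symm.restrictScalars R))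
  | succ m ih =>
    obtain ⟨b, q, hq, hT⟩ := hT
    obtain ⟨c, p, hp, d, r, hr, hS⟩ := hS
    obtain ⟨p', j, π, hp', hj, hπ, hex⟩ := exists_extension_ker_of_isSMulRegular hx q hq
    have : Module.Finite R (LinearMap.ker q) := .trans (R ⧸ Ideal.span {x}) _
    obtain ⟨a, t, ht⟩ := Module.Finite.exists_fin' R (LinearMap.ker q)
    obtain ⟨φ, hφ, hφt⟩ := LinearMap.exists_surjective_stablyIso_ker_of_exact j π hj hπ hex t ht
    obtain ⟨S', hS'⟩ := exists_isSyzygyOf R m (LinearMap.ker t)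
    have hrt : StablyIso R (LinearMap.ker r) (LinearMap.ker t) :=
      (LinearMap.stablyIso_ker_of_stablyIso (LinearMap.stablyIso_ker p p' hp hp') r φ hr hφ).trans
        hφt
    exact (IsSyzygyOf.stablyIso m hS hS' hrt).trans (ih ⟨a, t, ht, hS'⟩ hT)

end Quotient

/-- For a nonzerodivisor `x ∈ R` and a finitely generated `R/xR`-module `N` (viewed as an
`R`-module by restriction of scalars), the modules `Ω_R^{m+1}(N)` and `Ω_R(Ω^m_{R/xR}(N))`
are stably isomorphic over `R`: they become isomorphic after adding suitable finitely
generated projective `R`-modules. -/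
theorem stmt_14 (R : Type) [CommRing R] [IsNoetherianRing R] [IsLocalRing R]
    (x : R) (hx : IsSMulRegular R x)
    (N : Type) [AddCommGroup N] [Module (R ⧸ Ideal.span {x}) N] [Module R N]
    [IsScalarTower R (R ⧸ Ideal.span {x}) N] [Module.Finite (R ⧸ Ideal.span {x}) N]
    (m : ℕ)
    (S : Type) [AddCommGroup S] [Module R S] (hS : IsSyzygyOf R (m + 1) S N)
    (T : Type) [AddCommGroup T] [Module (R ⧸ Ideal.span {x}) T] [Module R T]
    [IsScalarTower R (R ⧸ Ideal.span {x}) T]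
    (hT : IsSyzygyOf (R ⧸ Ideal.span {x}) m T N)
    (U : Type) [AddCommGroup U] [Module R U] (hU : IsSyzygyOf R 1 U T) :
    ∃ (P Q : ModuleCat.{0} R), Module.Finite R P ∧ Module.Projective R P ∧
      Module.Finite R Q ∧ Module.Projective R Q ∧
      Nonempty ((S × P) ≃ₗ[R] (U × Q)) := by
  exact stablyIso_of_isSyzygyOf_quotient hx m hS hT hU
end
end

section
/- Let R be a commutative noetherian local ring with residue field k, M a finitely generated R-module, and n ≥ 1. Suppose Ext^i_R(M, R) = 0 for all 1 ≤ i ≤ n, and suppose M ≅ X ⊕ R^a with X stable. If f : M → k is an R-linear map whose induced map Ω^j f on j-th syzygies factors through a projective for some 0 ≤ j ≤ n, then already f itself factors through a projective; consequently ξ(j, M) = a for all 0 ≤ j ≤ n. -/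
noncomputable section

/-- A linear map factors through a finitely generated free module
(equivalently, through a projective module, for maps between finitely
generated modules). -/
def FactorsThruFree (R : Type) [Ring R] {M N : Type} [AddCommGroup M] [Module R M]
    [AddCommGroup N] [Module R N] (f : M →ₗ[R] N) : Prop :=
  ∃ (b : ℕ) (g : (Fin b → R) →ₗ[R] N) (h : M →ₗ[R] (Fin b → R)), f = g ∘ₗ h

/-- `SyzFactors R n f` : an induced map `Ω^n f` between `n`-th syzygies of `M` and `N`
(computed from chosen free covers) factors through a projective (= f.g. free) module. -/
def SyzFactors (R : Type) [Ring R] :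
    (n : ℕ) → {M : Type} → [AddCommGroup M] → [Module R M] →
      {N : Type} → [AddCommGroup N] → [Module R N] → (M →ₗ[R] N) → Prop
  | 0, _M, _, _, _N, _, _, f => FactorsThruFree R f
  | n + 1, _M, _, _, _N, _, _, f =>
      ∃ (a b : ℕ) (p : (Fin a → R) →ₗ[R] _M) (q : (Fin b → R) →ₗ[R] _N)
        (φ : (Fin a → R) →ₗ[R] (Fin b → R)),
        Function.Surjective p ∧ Function.Surjective q ∧
        ∃ hcomm : q ∘ₗ φ = f ∘ₗ p,
          SyzFactors R n (φ.restrict (p := LinearMap.ker p) (q := LinearMap.ker q)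
            (fun x hx => by
              have h1 : q (φ x) = f (p x) := LinearMap.congr_fun hcomm x
              rw [LinearMap.mem_ker] at hx ⊢
              rw [h1, hx, map_zero]))

/-- `M` is stable: it has no nonzero free direct summand.  (Over any ring, a f.g. module
has a nonzero free direct summand iff it admits a surjective linear map onto `R`.) -/
def IsStable (R : Type) [Ring R] (M : Type) [AddCommGroup M] [Module R M] : Prop :=
  ∀ p : M →ₗ[R] R, ¬ Function.Surjective p

/-- The `n`-th approximated ξ-invariant: the dimension over the residue field `k` of the
subspace of `Hom_R(M, k)` of maps whose `n`-th syzygy factors through a projective. -/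
def xi (R : Type) [CommRing R] [IsLocalRing R] (n : ℕ)
    (M : Type) [AddCommGroup M] [Module R M] : ℕ :=
  Module.finrank (IsLocalRing.ResidueField R)
    (Submodule.span (IsLocalRing.ResidueField R)
      {f : M →ₗ[R] IsLocalRing.ResidueField R | SyzFactors R n f})

open CategoryTheory in
/-- The Ext module `Ext^i_R(X, R)` over a commutative ring `R`. -/
def extMod (R : Type) [CommRing R] (i : ℕ) (X : Type) [AddCommGroup X] [Module R X] :
    ModuleCat R :=
  ((Ext R (ModuleCat.{0} R) i).obj (Opposite.op (ModuleCat.of R X))).obj (ModuleCat.of R R)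

open CategoryTheory in
/-- Vanishing of the derived-functor `Ext` module implies vanishing of the corresponding
`Ext` group defined by the derived category. -/
lemma subsingleton_abelianExt_of_extMod (R : Type) [CommRing R] (M : Type) [AddCommGroup M]
    [Module R M] (i : ℕ) (h : Subsingleton (extMod R (i + 1) M)) :
    Subsingleton (Abelian.Ext.{0} (ModuleCat.of R M) (ModuleCat.of R R) (i + 1)) := by
  let P := projectiveResolution (ModuleCat.of R M)
  have hz : Limits.IsZero (extMod R (i + 1) M) := ModuleCat.isZero_of_subsingleton _
  have hz' := hz.of_iso (P.isoExt (R := R) (i + 1) (ModuleCat.of R R)).symm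
  rw [← HomologicalComplex.exactAt_iff_isZero_homology,
    HomologicalComplex.exactAt_iff' _ i (i + 1) (i + 2) (by simp) (by simp),
    ShortComplex.moduleCat_exact_iff] at hz'
  refine subsingleton_of_forall_eq 0 fun α => ?_
  obtain ⟨f, hf, rfl⟩ := P.extMk_surjective α (i + 2) rfl
  rw [P.extMk_eq_zero_iff f _ rfl hf i rfl]
  obtain ⟨g, hg⟩ := hz' f hf
  exact ⟨g, hg⟩

section Shifting

open CategoryTheory

variable {R : Type} [CommRing R] {M F N : Type} [AddCommGroup M] [Module R M]
  [AddCommGroup F] [Module R F] [AddCommGroup N] [Module R N]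

lemma subsingleton_abelianExt_ker [Module.Projective R F] {p : F →ₗ[R] M} (hp : Function.Surjective p) (i : ℕ)
    (h : Subsingleton (Abelian.Ext.{0} (ModuleCat.of R M) (ModuleCat.of R N) (i + 2))) :
    Subsingleton
      (Abelian.Ext.{0} (ModuleCat.of R (LinearMap.ker p)) (ModuleCat.of R N) (i + 1)) := by
  have hS := LinearMap.shortExact_shortComplexKer hp
  have : Projective p.shortComplexKer.X₂ :=
    inferInstanceAs (Projective (ModuleCat.of R F))
  refine subsingleton_of_forall_eq 0 fun α => ?_
  obtain ⟨x, rfl⟩ := Abelian.Ext.contravariant_sequence_exact₁ hS (ModuleCat.of R N) α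
    (n₁ := i + 2) (by omega) (h.elim _ _)
  rw [Abelian.Ext.eq_zero_of_projective x, Abelian.Ext.comp_zero]

lemma exists_extension_of_subsingleton_abelianExt_one {p : F →ₗ[R] M}
    (hp : Function.Surjective p)
    (h : Subsingleton (Abelian.Ext.{0} (ModuleCat.of R M) (ModuleCat.of R N) 1))
    (u : LinearMap.ker p →ₗ[R] N) :
    ∃ v : F →ₗ[R] N, v ∘ₗ (LinearMap.ker p).subtype = u := by
  have hS := LinearMap.shortExact_shortComplexKer hp
  obtain ⟨x, hx⟩ := Abelian.Ext.contravariant_sequence_exact₁ hS (ModuleCat.of R N)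
    (Abelian.Ext.mk₀ (ModuleCat.ofHom u))
    (n₁ := 1) rfl (h.elim _ _)
  obtain ⟨v, rfl⟩ := (Abelian.Ext.mk₀_bijective _ _).2 x
  rw [Abelian.Ext.mk₀_comp_mk₀] at hx
  have hx' := (Abelian.Ext.mk₀_bijective _ _).1 hx
  exact ⟨v.hom, by simpa using congrArg ModuleCat.Hom.hom hx'⟩

end Shifting

/-- If `Ext^i(M, R) = 0` for `1 ≤ i ≤ j`, then a map out of `M` whose `j`-th syzygy factors
through a free module factors through a free module itself. -/
lemma FactorsThruFree.of_syzFactors {R : Type} [CommRing R] (j : ℕ) {M N : Type}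
    [AddCommGroup M] [Module R M] [AddCommGroup N] [Module R N]
    (hext : ∀ i < j, Subsingleton
      (CategoryTheory.Abelian.Ext.{0} (ModuleCat.of R M) (ModuleCat.of R R) (i + 1)))
    (f : M →ₗ[R] N) (hf : SyzFactors R j f) : FactorsThruFree R f := by
  induction j generalizing M N with
  | zero => exact hf
  | succ j ih =>
    obtain ⟨a, b, p, q, φ, hp, hq, hcomm, hsyz⟩ := hf
    obtain ⟨c, g, h, hgh⟩ := ih
      (fun i hi => subsingleton_abelianExt_ker hp i (hext (i + 1) (by omega))) _ hsyz
    choose v hv using fun t => exists_extension_of_subsingleton_abelianExt_one hp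
      (hext 0 (by omega)) (LinearMap.proj t ∘ₗ h)
    let ψ : (Fin a → R) →ₗ[R] (Fin b → R) :=
      (LinearMap.ker q).subtype ∘ₗ g ∘ₗ LinearMap.pi v
    have hker : LinearMap.ker p ≤ LinearMap.ker (φ - ψ) := by
      intro x hx
      have h1 : LinearMap.pi v x = h ⟨x, hx⟩ :=
        funext fun t => LinearMap.congr_fun (hv t) ⟨x, hx⟩
      have h2 : φ x = (g (h ⟨x, hx⟩) : Fin b → R) :=
        congrArg Subtype.val (LinearMap.congr_fun hgh ⟨x, hx⟩)
      simp [ψ, h1, h2]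
    refine ⟨b, q, (LinearMap.ker p).liftQ (φ - ψ) hker ∘ₗ
      (p.quotKerEquivOfSurjective hp).symm.toLinearMap, ?_⟩
    ext m
    obtain ⟨x, rfl⟩ := hp m
    have h3 : (p.quotKerEquivOfSurjective hp).symm (p x) = Submodule.Quotient.mk x :=
      (LinearEquiv.symm_apply_eq _).2 rfl
    have h4 : q (φ x) = f (p x) := LinearMap.congr_fun hcomm x
    have h5 : q (ψ x) = 0 := (g (LinearMap.pi v x)).2
    simp [h3, h4, h5]

/-- Over a noetherian ring, all syzygies of a map factoring through a free module factor
through a free module. -/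
lemma FactorsThruFree.syzFactors {R : Type} [CommRing R] [IsNoetherianRing R] (j : ℕ)
    {M N : Type} [AddCommGroup M] [Module R M] [Module.Finite R M]
    [AddCommGroup N] [Module R N] [Module.Finite R N]
    {f : M →ₗ[R] N} (hf : FactorsThruFree R f) : SyzFactors R j f := by
  induction j generalizing M N with
  | zero => exact hf
  | succ j ih =>
    obtain ⟨c, g, h, rfl⟩ := hf
    obtain ⟨a, p, hp⟩ := Module.Finite.exists_fin' R M
    obtain ⟨b, q, hq⟩ := Module.Finite.exists_fin' R N
    obtain ⟨g', hg'⟩ := Module.projective_lifting_property q g hq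
    refine ⟨a, b, p, q, g' ∘ₗ h ∘ₗ p, hp, hq, ?_, ih ⟨0, 0, 0, ?_⟩⟩
    · rw [← hg']; rfl
    · ext x t
      have hx : p x = 0 := x.2
      simp [hx]

section Local

open IsLocalRing

variable {R : Type} [CommRing R] [IsLocalRing R]

/-- A map from a stable module to the residue field that factors through a free module is
zero. -/
lemma FactorsThruFree.eq_zero_of_isStable {X : Type} [AddCommGroup X] [Module R X]
    (hX : IsStable R X) {f : X →ₗ[R] ResidueField R} (hf : FactorsThruFree R f) : f = 0 := by
  obtain ⟨b, g, h, rfl⟩ := hf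
  ext x
  have hmem (t : Fin b) : residue R (h x t) = 0 := by
    rw [residue_eq_zero_iff, mem_maximalIdeal, mem_nonunits_iff]
    rintro ⟨u, hu⟩
    refine hX (LinearMap.proj t ∘ₗ h) fun r => ⟨(r * (↑u⁻¹ : R)) • x, ?_⟩
    simp [← hu, mul_assoc]
  have hsum : h x = ∑ t, h x t • Pi.single t (1 : R) := by
    simpa using (pi_eq_sum_univ' (h x))
  have hsmul (r : R) (y : ResidueField R) : r • y = residue R r * y := Algebra.smul_def r y
  rw [LinearMap.comp_apply, hsum]
  simp [hsmul, hmem]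

/-- For `M ≅ X ⊕ R^a` with `X` stable, the maps `M → k` factoring through a free module span
a space of dimension `a`. -/
lemma finrank_span_factorsThruFree {M X : Type} [AddCommGroup M] [Module R M]
    [AddCommGroup X] [Module R X] {a : ℕ} (hX : IsStable R X) (e : M ≃ₗ[R] X × (Fin a → R)) :
    Module.finrank (ResidueField R) (Submodule.span (ResidueField R)
      {f : M →ₗ[R] ResidueField R | FactorsThruFree R f}) = a := by
  let v (t : Fin a) : M →ₗ[R] ResidueField R :=
    Algebra.linearMap R (ResidueField R) ∘ₗ LinearMap.proj t ∘ₗ LinearMap.snd R X _ ∘ₗ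
      e.toLinearMap
  have hv (t : Fin a) (m : M) : v t m = residue R ((e m).2 t) := rfl
  have hspan : Submodule.span (ResidueField R)
      {f : M →ₗ[R] ResidueField R | FactorsThruFree R f} =
      Submodule.span (ResidueField R) (Set.range v) := by
    apply le_antisymm
    · rw [Submodule.span_le]
      rintro f ⟨b, g, h, hgh⟩
      have h0 : f ∘ₗ e.symm.toLinearMap ∘ₗ LinearMap.inl R X (Fin a → R) = 0 :=
        FactorsThruFree.eq_zero_of_isStable hX
          ⟨b, g, h ∘ₗ e.symm.toLinearMap ∘ₗ LinearMap.inl R X (Fin a → R), by rw [hgh]; rfl⟩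
      have hf : f = ∑ t, f (e.symm (0, Pi.single t 1)) • v t := by
        ext m
        obtain ⟨⟨x, r⟩, rfl⟩ := e.symm.surjective m
        have hx : f (e.symm (x, 0)) = 0 := LinearMap.congr_fun h0 x
        have hr : r = ∑ t, r t • Pi.single t (1 : R) := by
          simpa using (pi_eq_sum_univ' r)
        have hsplit : f (e.symm (x, r)) = f (e.symm (0, r)) := by
          have : ((x, r) : X × (Fin a → R)) = (x, 0) + (0, r) := by simp
          rw [this, map_add, map_add, hx, zero_add]
        have hlin : f (e.symm (0, r)) = ∑ t, r t • f (e.symm (0, Pi.single t 1)) := by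
          have hL := congrArg (f ∘ₗ e.symm.toLinearMap ∘ₗ LinearMap.inr R X (Fin a → R)) hr
          rw [map_sum] at hL
          simp only [map_smul] at hL
          exact hL
        rw [hsplit, hlin]
        simp [hv, Algebra.smul_def, mul_comm]
      rw [hf]
      exact Submodule.sum_mem _ fun t _ =>
        Submodule.smul_mem _ _ (Submodule.subset_span ⟨t, rfl⟩)
    · refine Submodule.span_mono ?_
      rintro _ ⟨t, rfl⟩
      exact ⟨a, Algebra.linearMap R (ResidueField R) ∘ₗ LinearMap.proj t,
        LinearMap.snd R X _ ∘ₗ e.toLinearMap, rfl⟩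
  have hli : LinearIndependent (ResidueField R) v := by
    rw [Fintype.linearIndependent_iff]
    intro c hc t
    have := LinearMap.congr_fun hc (e.symm (0, Pi.single t 1))
    simpa [hv, Pi.single_apply, apply_ite] using this
  rw [hspan, finrank_span_eq_card hli, Fintype.card_fin]

end Local


/-- Suppose `Ext^i(M,R) = 0` for `1 ≤ i ≤ n` and `M ≅ X ⊕ R^a` with `X` stable.  If
`f : M → k` has `Ω^j f` factoring through a projective for some `j ≤ n`, then `f` itself
factors through a projective; consequently `ξ(j, M) = a` for all `0 ≤ j ≤ n`. -/
theorem stmt_19 (R : Type) [CommRing R] [IsNoetherianRing R] [IsLocalRing R]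
    (M X : Type) [AddCommGroup M] [Module R M] [Module.Finite R M]
    [AddCommGroup X] [Module R X] [Module.Finite R X]
    (a n : ℕ) (hn : 1 ≤ n)
    (hext : ∀ i, 1 ≤ i → i ≤ n → Subsingleton (extMod R i M))
    (hX : IsStable R X) (e : Nonempty (M ≃ₗ[R] X × (Fin a → R))) :
    (∀ (j : ℕ), j ≤ n → ∀ f : M →ₗ[R] IsLocalRing.ResidueField R,
        SyzFactors R j f → FactorsThruFree R f) ∧
    (∀ j : ℕ, j ≤ n → xi R j M = a) := by
  have hfactors : ∀ (j : ℕ), j ≤ n → ∀ f : M →ₗ[R] IsLocalRing.ResidueField R,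
      SyzFactors R j f → FactorsThruFree R f := fun j hj f hf =>
    FactorsThruFree.of_syzFactors j (fun i hi => subsingleton_abelianExt_of_extMod R M i
      (hext (i + 1) (by omega) (by omega))) f hf
  refine ⟨hfactors, fun j hj => ?_⟩
  obtain ⟨e⟩ := e
  rw [← finrank_span_factorsThruFree hX e, xi]
  have hset : {f : M →ₗ[R] IsLocalRing.ResidueField R | SyzFactors R j f} =
      {f | FactorsThruFree R f} :=
    Set.ext fun f => ⟨hfactors j hj f, fun hf => hf.syzFactors j⟩
  rw [hset]
end
end
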